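/- Set P̲_r^s(μ) := liminf_{k→∞} N_{k,r}^{1/s} e_{N_{k,r},r}(μ) and P̄_r^s(μ) := limsup_{k→∞} N_{k,r}^{1/s} e_{N_{k,r},r}(μ), and Q̲_r^s(μ) := liminf_{n→∞} n^{1/s} e_{n,r}(μ), Q̄_r^s(μ) := limsup_{n→∞} n^{1/s} e_{n,r}(μ). Then for every s > 0: Q̲_r^s(μ) > 0 if and only if P̲_r^s(μ) > 0; Q̲_r^s(μ) < ∞ if and only if P̲_r^s(μ) < ∞; Q̄_r^s(μ) > 0 if and only if P̄_r^s(μ) > 0; and Q̄_r^s(μ) < ∞ if and only if P̄_r^s(μ) < ∞. -/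

import Mathlib

open MeasureTheory Filter

/-- The `n`-th quantization error of order `r` of a Borel measure `P` on `ℝ^q`:
the infimum of `(∫ d(x,α)^r dP)^{1/r}` over finite sets `α` with `1 ≤ card α ≤ n`. -/
noncomputable def quantErr {q : ℕ} (P : Measure (EuclideanSpace ℝ (Fin q)))
    (n : ℕ) (r : ℝ) : ℝ :=
  sInf ((fun α : Finset (EuclideanSpace ℝ (Fin q)) =>
      (∫ x, Metric.infDist x (α : Set (EuclideanSpace ℝ (Fin q))) ^ r ∂P) ^ (1 / r)) ''
    {α : Finset (EuclideanSpace ℝ (Fin q)) | α.Nonempty ∧ α.card ≤ n})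

/-- Product of weights `g` along a word `σ` (equals `1` for the empty word). -/
noncomputable def prodw {N : ℕ} (g : Fin N → ℝ) (σ : List (Fin N)) : ℝ := (σ.map g).prod

/-- The composition `f_{σ_1} ∘ ⋯ ∘ f_{σ_n}` along a word `σ`. -/
def wordMap {q N : ℕ} (f : Fin N → EuclideanSpace ℝ (Fin q) → EuclideanSpace ℝ (Fin q))
    (σ : List (Fin N)) : EuclideanSpace ℝ (Fin q) → EuclideanSpace ℝ (Fin q) :=
  σ.foldr (fun i g => f i ∘ g) id

/-- `h(σ) = h^{(1)}(σ) + h^{(2)}(σ)` where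
`h^{(1)}(σ) = Σ_{j=0}^{|σ|-1} p0 p_{σ|_j} t_{σ^{(l)}_{-j}} s_σ^r` and `h^{(2)}(σ) = p_σ s_σ^r`. -/
noncomputable def hfun {N : ℕ} (r p0 : ℝ) (s t p : Fin N → ℝ) (σ : List (Fin N)) : ℝ :=
  (∑ j ∈ Finset.range σ.length, p0 * prodw p (σ.take j) * prodw t (σ.drop j)) * prodw s σ ^ r
    + prodw p σ * prodw s σ ^ r

/-- `η̲_r := min_{1 ≤ i ≤ N} min{p0 t_i + p_i, t_i} · s_i^r`. -/
noncomputable def etaLow {N : ℕ} (r p0 : ℝ) (s t p : Fin N → ℝ) : ℝ :=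
  ⨅ i, min (p0 * t i + p i) (t i) * s i ^ r

/-- The finite maximal antichain `Λ_{k,r} = {σ : h(σ|_{|σ|-1}) ≥ η̲_r/k > h(σ)}`. -/
def Lam {N : ℕ} (r p0 : ℝ) (s t p : Fin N → ℝ) (k : ℕ) : Set (List (Fin N)) :=
  {σ | σ ≠ [] ∧ etaLow r p0 s t p / k ≤ hfun r p0 s t p σ.dropLast ∧
    hfun r p0 s t p σ < etaLow r p0 s t p / k}

/-- `a(x) = Σ_i (t_i s_i^r)^{x/(x+r)}` (also used for `b` with `p` in place of `t`). -/
noncomputable def afun {N : ℕ} (r : ℝ) (s t : Fin N → ℝ) (x : ℝ) : ℝ :=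
  ∑ i, (t i * s i ^ r) ^ (x / (x + r))

section Coefficients

lemma coefficient_liminf_transfer {u v : ℕ → ℝ} {D : ℝ} (hD : 0 < D) {φ : ℕ → ℕ}
    (hφ : Tendsto φ atTop atTop) (h : ∀ᶠ n in atTop, u (φ n) ≤ D * v n) :
    (0 < liminf (fun n => (u n : EReal)) atTop → 0 < liminf (fun n => (v n : EReal)) atTop) ∧
    (liminf (fun n => (v n : EReal)) atTop < ⊤ → liminf (fun n => (u n : EReal)) atTop < ⊤) := by
  constructor
  · intro h0
    obtain ⟨δ, hδ0, hδ⟩ := EReal.lt_iff_exists_real_btwn.1 h0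
    have hev := hφ.eventually (eventually_lt_of_lt_liminf hδ)
    have hδ0' : 0 < δ := by exact_mod_cast hδ0
    have hpos : (0 : EReal) < ((δ / D : ℝ) : EReal) := by exact_mod_cast div_pos hδ0' hD
    refine hpos.trans_le (le_liminf_of_le (by isBoundedDefault) ?_)
    filter_upwards [hev, h] with n h1 h2
    have h1' : δ < u (φ n) := by exact_mod_cast h1
    have : δ / D ≤ v n := by rw [div_le_iff₀' hD]; linarith
    exact_mod_cast this
  · intro h0
    obtain ⟨M, hM, -⟩ := EReal.lt_iff_exists_real_btwn.1 h0
    have hfr := (frequently_lt_of_liminf_lt (by isBoundedDefault) hM).and_eventually h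
    have hfr' : ∃ᶠ n in atTop, (u n : EReal) ≤ ((D * M : ℝ) : EReal) := by
      refine hφ.frequently (hfr.mono ?_)
      rintro n ⟨h1, h2⟩
      have h1' : v n < M := by exact_mod_cast h1
      have : u (φ n) ≤ D * M := h2.trans (by gcongr)
      exact_mod_cast this
    exact (liminf_le_of_frequently_le hfr' (by isBoundedDefault)).trans_lt (EReal.coe_lt_top _)

lemma coefficient_limsup_transfer {u v : ℕ → ℝ} {D : ℝ} (hD : 0 < D) {φ : ℕ → ℕ}
    (hφ : Tendsto φ atTop atTop) (h : ∀ᶠ n in atTop, v n ≤ D * u (φ n)) :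
    (0 < limsup (fun n => (v n : EReal)) atTop → 0 < limsup (fun n => (u n : EReal)) atTop) ∧
    (limsup (fun n => (u n : EReal)) atTop < ⊤ → limsup (fun n => (v n : EReal)) atTop < ⊤) := by
  constructor
  · intro h0
    obtain ⟨δ, hδ0, hδ⟩ := EReal.lt_iff_exists_real_btwn.1 h0
    have hδ0' : 0 < δ := by exact_mod_cast hδ0
    have hpos : (0 : EReal) < ((δ / D : ℝ) : EReal) := by exact_mod_cast div_pos hδ0' hD
    have hfr := (frequently_lt_of_lt_limsup (by isBoundedDefault) hδ).and_eventually h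
    have hfr' : ∃ᶠ n in atTop, ((δ / D : ℝ) : EReal) ≤ (u n : EReal) := by
      refine hφ.frequently (hfr.mono ?_)
      rintro n ⟨h1, h2⟩
      have h1' : δ < v n := by exact_mod_cast h1
      have : δ / D ≤ u (φ n) := by rw [div_le_iff₀' hD]; linarith
      exact_mod_cast this
    exact hpos.trans_le (le_limsup_of_frequently_le hfr' (by isBoundedDefault))
  · intro h0
    obtain ⟨M, hM, -⟩ := EReal.lt_iff_exists_real_btwn.1 h0
    have hev := hφ.eventually (eventually_lt_of_limsup_lt hM)
    refine (limsup_le_of_le (a := ((D * M : ℝ) : EReal)) (by isBoundedDefault) ?_).trans_lt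
      (EReal.coe_lt_top _)
    filter_upwards [hev, h] with n h1 h2
    have h1' : u (φ n) < M := by exact_mod_cast h1
    have : v n ≤ D * M := h2.trans (by gcongr)
    exact_mod_cast this

/-- A divergent integer sequence admits, for each large `n`, consecutive terms bracketing `n`. -/
lemma exists_bracketing_index {a : ℕ → ℕ} (ha : Tendsto a atTop atTop) :
    ∃ φ : ℕ → ℕ, Tendsto φ atTop atTop ∧
      ∀ᶠ n in atTop, a (φ n) ≤ n ∧ n < a (φ n + 1) := by
  have hbdd (n : ℕ) : BddAbove {k | a k ≤ n} := by
    obtain ⟨K, hK⟩ := eventually_atTop.1 (ha.eventually_gt_atTop n)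
    refine ⟨K, fun k hk => ?_⟩
    by_contra hlt
    exact absurd (hK k (not_le.1 hlt).le) (not_lt.2 hk)
  refine ⟨fun n => sSup {k | a k ≤ n}, ?_, ?_⟩
  · refine tendsto_atTop.2 fun K => ?_
    filter_upwards [eventually_ge_atTop (a K)] with n hn
    exact le_csSup (hbdd n) hn
  · filter_upwards [eventually_ge_atTop (a 0)] with n hn
    refine ⟨Nat.sSup_mem ⟨0, hn⟩ (hbdd n), ?_⟩
    by_contra hlt
    have := le_csSup (hbdd n) (show _ ∈ {k | a k ≤ n} from not_lt.1 hlt)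
    omega

lemma coefficient_iff_of_bounded_growth {e : ℕ → ℝ} (he0 : ∀ n, 0 ≤ e n)
    (he : ∀ m n, 1 ≤ m → m ≤ n → e n ≤ e m) {a : ℕ → ℕ} (ha : Tendsto a atTop atTop)
    {C : ℕ} (hC : ∀ k, 1 ≤ k → a (k + 1) ≤ C * a k) {x : ℝ} (hx : 0 < x) :
    let F : ℕ → ℝ := fun n => (n : ℝ) ^ (1 / x) * e n
    ((0 < liminf (fun n => (F n : EReal)) atTop) ↔
      (0 < liminf (fun k => (F (a k) : EReal)) atTop)) ∧
    ((liminf (fun n => (F n : EReal)) atTop < ⊤) ↔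
      (liminf (fun k => (F (a k) : EReal)) atTop < ⊤)) ∧
    ((0 < limsup (fun n => (F n : EReal)) atTop) ↔
      (0 < limsup (fun k => (F (a k) : EReal)) atTop)) ∧
    ((limsup (fun n => (F n : EReal)) atTop < ⊤) ↔
      (limsup (fun k => (F (a k) : EReal)) atTop < ⊤)) := by
  intro F
  obtain ⟨φ, hφ, hb⟩ := exists_bracketing_index ha
  have hx' : 0 ≤ 1 / x := by positivity
  have hD : (0 : ℝ) < ((C : ℝ) + 1) ^ (1 / x) := by positivity
  have hscale {l m : ℕ} (h : l ≤ C * m) :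
      (l : ℝ) ^ (1 / x) ≤ ((C : ℝ) + 1) ^ (1 / x) * (m : ℝ) ^ (1 / x) := by
    rw [← Real.mul_rpow (by positivity) (by positivity)]
    refine Real.rpow_le_rpow (by positivity) ?_ hx'
    have h' : (l : ℝ) ≤ C * m := by exact_mod_cast h
    nlinarith [(Nat.cast_nonneg m : (0 : ℝ) ≤ m)]
  have hupper : ∀ᶠ n in atTop, F n ≤ ((C : ℝ) + 1) ^ (1 / x) * F (a (φ n)) := by
    filter_upwards [hb, hφ.eventually_ge_atTop 1, (ha.comp hφ).eventually_ge_atTop 1]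
      with n ⟨h1, h2⟩ h3 h4
    have := mul_le_mul (hscale (h2.le.trans (hC _ h3))) (he _ _ h4 h1) (he0 _) (by positivity)
    simpa only [F, Function.comp_apply, mul_assoc] using this
  have hlower : ∀ᶠ n in atTop, F (a (φ n + 1)) ≤ ((C : ℝ) + 1) ^ (1 / x) * F n := by
    filter_upwards [hb, hφ.eventually_ge_atTop 1, eventually_ge_atTop 1] with n ⟨h1, h2⟩ h3 h4
    have := mul_le_mul (hscale ((hC _ h3).trans (Nat.mul_le_mul_left C h1))) (he _ _ h4 h2.le)
      (he0 _) (by positivity)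
    simpa only [F, Function.comp_apply, mul_assoc] using this
  have hsub : ∀ᶠ k in atTop, F (a k) ≤ 1 * F (a k) := by simp
  have l₁ := coefficient_liminf_transfer (u := F) (v := fun k => F (a k)) one_pos ha hsub
  have l₂ := coefficient_liminf_transfer (u := fun k => F (a k)) (v := F) hD
    ((tendsto_add_atTop_nat 1).comp hφ) hlower
  have m₁ := coefficient_limsup_transfer (u := F) (v := fun k => F (a k)) one_pos ha hsub
  have m₂ := coefficient_limsup_transfer (u := fun k => F (a k)) (v := F) hD hφ hupper
  exact ⟨⟨l₁.1, l₂.1⟩, ⟨l₂.2, l₁.2⟩, ⟨m₂.1, m₁.1⟩, ⟨m₁.2, m₂.2⟩⟩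

end Coefficients

section QuantizationError

variable {q : ℕ} (P : Measure (EuclideanSpace ℝ (Fin q)))

lemma rpow_integral_infDist_nonneg (r : ℝ) (α : Set (EuclideanSpace ℝ (Fin q))) :
    0 ≤ (∫ x, Metric.infDist x α ^ r ∂P) ^ (1 / r) :=
  Real.rpow_nonneg (integral_nonneg fun _ => Real.rpow_nonneg Metric.infDist_nonneg _) _

lemma quantErr_nonneg (n : ℕ) (r : ℝ) : 0 ≤ quantErr P n r :=
  Real.sInf_nonneg (by rintro _ ⟨α, -, rfl⟩; exact rpow_integral_infDist_nonneg P r _)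

lemma quantErr_le_of_le (r : ℝ) (m n : ℕ) (hm : 1 ≤ m) (hmn : m ≤ n) :
    quantErr P n r ≤ quantErr P m r := by
  refine csInf_le_csInf ⟨0, ?_⟩ (Set.Nonempty.image _ ⟨{0}, by simpa using hm⟩)
    (Set.image_mono fun α hα => ⟨hα.1, hα.2.trans hmn⟩)
  rintro _ ⟨α, -, rfl⟩
  exact rpow_integral_infDist_nonneg P r _

end QuantizationError

section Antichain

variable {N : ℕ} {r p0 : ℝ} {s t p : Fin N → ℝ}

lemma prodw_append (g : Fin N → ℝ) (σ τ : List (Fin N)) :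
    prodw g (σ ++ τ) = prodw g σ * prodw g τ := by simp [prodw]

lemma prodw_singleton (g : Fin N → ℝ) (i : Fin N) : prodw g [i] = g i := by simp [prodw]

lemma prodw_pos {g : Fin N → ℝ} (hg : ∀ i, 0 < g i) (σ : List (Fin N)) : 0 < prodw g σ := by
  refine List.prod_pos fun a ha => ?_
  obtain ⟨i, -, rfl⟩ := List.mem_map.1 ha
  exact hg i

lemma hfun_nil : hfun r p0 s t p [] = 1 := by simp [hfun, prodw]

lemma hfun_pos (hp0 : 0 < p0) (hs : ∀ i, 0 < s i) (ht : ∀ i, 0 < t i) (hp : ∀ i, 0 < p i)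
    (σ : List (Fin N)) : 0 < hfun r p0 s t p σ := by
  have hS := Real.rpow_pos_of_pos (prodw_pos hs σ) r
  have hA : 0 ≤ ∑ j ∈ Finset.range σ.length, p0 * prodw p (σ.take j) * prodw t (σ.drop j) :=
    Finset.sum_nonneg fun j _ =>
      mul_nonneg (mul_nonneg hp0.le (prodw_pos hp _).le) (prodw_pos ht _).le
  have := mul_pos (prodw_pos hp σ) hS
  have := mul_nonneg hA hS.le
  rw [hfun]
  linarith

lemma hfun_concat (hs : ∀ i, 0 < s i) (σ : List (Fin N)) (i : Fin N) :
    hfun r p0 s t p (σ ++ [i]) =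
      ((∑ j ∈ Finset.range σ.length, p0 * prodw p (σ.take j) * prodw t (σ.drop j)) * t i
        + prodw p σ * (p0 * t i + p i)) * prodw s σ ^ r * s i ^ r := by
  have hsum : ∑ j ∈ Finset.range σ.length,
      p0 * prodw p ((σ ++ [i]).take j) * prodw t ((σ ++ [i]).drop j) =
      (∑ j ∈ Finset.range σ.length, p0 * prodw p (σ.take j) * prodw t (σ.drop j)) * t i := by
    rw [Finset.sum_mul]
    refine Finset.sum_congr rfl fun j hj => ?_
    have hj' := (Finset.mem_range.1 hj).le
    rw [List.take_append_of_le_length hj', List.drop_append_of_le_length hj', prodw_append,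
      prodw_singleton]
    ring
  rw [hfun, List.length_append, List.length_singleton, Finset.sum_range_succ, hsum,
    List.take_left, List.drop_left, prodw_append, prodw_append, prodw_singleton, prodw_singleton,
    prodw_singleton, Real.mul_rpow (prodw_pos hs σ).le (hs i).le]
  ring

lemma hfun_concat_le (hp0 : 0 < p0) (hs : ∀ i, 0 < s i) (ht : ∀ i, 0 < t i)
    (hp : ∀ i, 0 < p i) (ht1 : ∑ i, t i = 1) (hp1 : p0 + ∑ i, p i = 1) {c : ℝ}
    (hc : ∀ i, s i ^ r ≤ c) (σ : List (Fin N)) (i : Fin N) :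
    hfun r p0 s t p (σ ++ [i]) ≤ c * hfun r p0 s t p σ := by
  have hti : t i ≤ 1 := ht1 ▸
    Finset.single_le_sum (f := t) (fun j _ => (ht j).le) (Finset.mem_univ i)
  have hpi : p i ≤ ∑ i, p i :=
    Finset.single_le_sum (f := p) (fun j _ => (hp j).le) (Finset.mem_univ i)
  have hA : 0 ≤ ∑ j ∈ Finset.range σ.length, p0 * prodw p (σ.take j) * prodw t (σ.drop j) :=
    Finset.sum_nonneg fun j _ =>
      mul_nonneg (mul_nonneg hp0.le (prodw_pos hp _).le) (prodw_pos ht _).le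
  have hS := Real.rpow_pos_of_pos (prodw_pos hs σ) r
  have hP := prodw_pos hp σ
  have hw : p0 * t i + p i ≤ 1 := by nlinarith
  have hc0 : 0 ≤ c := (Real.rpow_pos_of_pos (hs i) r).le.trans (hc i)
  have hpos := hfun_pos (r := r) hp0 hs ht hp σ
  rw [hfun_concat hs]
  calc _ ≤ hfun r p0 s t p σ * s i ^ r := by
        refine mul_le_mul_of_nonneg_right ?_ (Real.rpow_pos_of_pos (hs i) r).le
        rw [hfun, ← add_mul]
        refine mul_le_mul_of_nonneg_right ?_ hS.le
        exact add_le_add (mul_le_of_le_one_right hA hti) (mul_le_of_le_one_right hP.le hw)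
    _ ≤ c * hfun r p0 s t p σ := by
        rw [mul_comm]
        exact mul_le_mul_of_nonneg_right (hc i) hpos.le

lemma le_pow_length_mul {h : List (Fin N) → ℝ} {c : ℝ} (hc : 0 ≤ c)
    (hstep : ∀ σ i, h (σ ++ [i]) ≤ c * h σ) (σ τ : List (Fin N)) :
    h (σ ++ τ) ≤ c ^ τ.length * h σ := by
  induction τ using List.reverseRecOn with
  | nil => simp
  | append_singleton τ i ih =>
    rw [← List.append_assoc, List.length_append, List.length_singleton, pow_succ', mul_assoc]
    exact (hstep _ _).trans (mul_le_mul_of_nonneg_left ih hc)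

/-- The words at which `h` first drops below the level `ε`. -/
def levelAntichain (h : List (Fin N) → ℝ) (ε : ℝ) : Set (List (Fin N)) :=
  {σ | σ ≠ [] ∧ ε ≤ h σ.dropLast ∧ h σ < ε}

lemma exists_append_mem_levelAntichain [NeZero N] {h : List (Fin N) → ℝ} {c ε : ℝ} (hc0 : 0 ≤ c)
    (hc1 : c < 1) (hstep : ∀ σ i, h (σ ++ [i]) ≤ c * h σ) (hε : 0 < ε) {w : List (Fin N)}
    (hw : ε ≤ h w) : ∃ u, w ++ u ∈ levelAntichain h ε := by
  classical
  have hex : ∃ m, h (w ++ List.replicate m 0) < ε := by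
    have hlim : Tendsto (fun m : ℕ => c ^ m * h w) atTop (nhds 0) := by
      simpa using (tendsto_pow_atTop_nhds_zero_of_lt_one hc0 hc1).mul_const (h w)
    obtain ⟨m, hm⟩ := (hlim.eventually_lt_const hε).exists
    refine ⟨m, (le_pow_length_mul hc0 hstep _ _).trans_lt ?_⟩
    rwa [List.length_replicate]
  obtain ⟨m, hm⟩ : ∃ m, Nat.find hex = m + 1 := by
    refine Nat.exists_eq_succ_of_ne_zero fun h0 => ?_
    have := Nat.find_spec hex
    rw [h0] at this
    simp at this
    linarith
  have hspec := Nat.find_spec hex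
  have hmin := Nat.find_min hex (m := m) (by omega)
  rw [hm] at hspec
  refine ⟨List.replicate (m + 1) 0, by simp, ?_, hspec⟩
  rw [List.replicate_succ', ← List.append_assoc, List.dropLast_concat]
  exact not_lt.1 hmin

lemma exists_prefix_mem_levelAntichain {h : List (Fin N) → ℝ} {ε : ℝ} (h0 : ε ≤ h [])
    {σ : List (Fin N)} (hσ : h σ < ε) : ∃ τ ∈ levelAntichain h ε, τ <+: σ := by
  induction σ using List.reverseRecOn with
  | nil => exact absurd hσ (not_lt.2 h0)
  | append_singleton σ i ih =>
    rcases lt_or_ge (h σ) ε with hlt | hge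
    · obtain ⟨τ, hτ, hpre⟩ := ih hlt
      exact ⟨τ, hτ, hpre.trans (List.prefix_append _ _)⟩
    · exact ⟨σ ++ [i], ⟨by simp, by simpa using hge, hσ⟩, List.prefix_rfl⟩

lemma levelAntichain_finite {h : List (Fin N) → ℝ} {c ε : ℝ} (hc0 : 0 ≤ c)
    (hc1 : c < 1) (hstep : ∀ σ i, h (σ ++ [i]) ≤ c * h σ) (hε : 0 < ε) :
    (levelAntichain h ε).Finite := by
  have hlim : Tendsto (fun m : ℕ => c ^ m * h []) atTop (nhds 0) := by
    simpa using (tendsto_pow_atTop_nhds_zero_of_lt_one hc0 hc1).mul_const (h [])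
  obtain ⟨K, hK⟩ := eventually_atTop.1 (hlim.eventually_lt_const hε)
  refine (List.finite_length_le (Fin N) K).subset ?_
  rintro σ ⟨-, hσ, -⟩
  by_contra hlen
  have hlen' : K < σ.length := not_le.1 hlen
  have h1 := le_pow_length_mul hc0 hstep [] σ.dropLast
  have h2 := hK σ.dropLast.length (by rw [List.length_dropLast]; omega)
  rw [List.nil_append] at h1
  linarith

lemma exists_ncard_levelAntichain_le {h : List (Fin N) → ℝ} {c : ℝ} (hc0 : 0 ≤ c)
    (hc1 : c < 1) (hstep : ∀ σ i, h (σ ++ [i]) ≤ c * h σ) :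
    ∃ C : ℕ, ∀ ε ε' : ℝ, 0 < ε → ε ≤ h [] → ε' ≤ ε → ε ≤ 2 * ε' →
      (levelAntichain h ε').ncard ≤ C * (levelAntichain h ε).ncard := by
  obtain ⟨K, hK⟩ := exists_pow_lt_of_lt_one (show (0 : ℝ) < 1 / 2 by norm_num) hc1
  have hBfin := List.finite_length_le (Fin N) K
  set B : Set (List (Fin N)) := {u | u.length ≤ K} with hB
  refine ⟨B.ncard, fun ε ε' hε h0 hle h2 => ?_⟩
  have hfin := levelAntichain_finite hc0 hc1 hstep hε
  have hsub : levelAntichain h ε' ⊆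
      (fun x : List (Fin N) × List (Fin N) => x.2 ++ x.1) '' (B ×ˢ levelAntichain h ε) := by
    rintro σ ⟨hne, hpar, hσ⟩
    obtain ⟨τ, hτ, u, rfl⟩ := exists_prefix_mem_levelAntichain h0 (hσ.trans_le hle)
    refine ⟨(u, τ), ⟨?_, hτ⟩, rfl⟩
    by_contra hu
    have hu' : K < u.length := not_le.1 hu
    have hune : u ≠ [] := by rintro rfl; simp at hu'
    rw [List.dropLast_append_of_ne_nil hune] at hpar
    have h3 := le_pow_length_mul hc0 hstep τ u.dropLast
    have h4 : c ^ u.dropLast.length ≤ c ^ K :=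
      pow_le_pow_of_le_one hc0 hc1.le (by rw [List.length_dropLast]; omega)
    have h5 : 0 ≤ c ^ u.dropLast.length := pow_nonneg hc0 _
    have h6 := hτ.2.2
    nlinarith
  calc _ ≤ _ := Set.ncard_le_ncard hsub ((hBfin.prod hfin).image _)
    _ ≤ _ := Set.ncard_image_le (hBfin.prod hfin)
    _ = _ := Set.ncard_prod

lemma tendsto_ncard_levelAntichain (hN : 2 ≤ N) {h : List (Fin N) → ℝ} {c : ℝ} (hc0 : 0 ≤ c)
    (hc1 : c < 1) (hstep : ∀ σ i, h (σ ++ [i]) ≤ c * h σ) (hpos : ∀ σ, 0 < h σ) {ε : ℕ → ℝ}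
    (hε : ∀ᶠ k in atTop, 0 < ε k) (hlim : Tendsto ε atTop (nhds 0)) :
    Tendsto (fun k => (levelAntichain h (ε k)).ncard) atTop atTop := by
  have : NeZero N := ⟨by omega⟩
  refine tendsto_atTop.2 fun L => ?_
  have hW : {w : List (Fin N) | w.length = L}.Finite := List.finite_length_eq (Fin N) L
  have hall : ∀ᶠ k in atTop, ∀ w ∈ {w : List (Fin N) | w.length = L}, ε k ≤ h w :=
    (eventually_all_finite hW).2 fun w _ => 
      (hlim.eventually_lt_const (hpos w)).mono fun _ => le_of_lt
  filter_upwards [hε, hall] with k hk hw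
  have hfin := levelAntichain_finite hc0 hc1 hstep hk
  have hsub : {w : List (Fin N) | w.length = L} ⊆ List.take L '' levelAntichain h (ε k) := by
    intro w hwL
    obtain ⟨u, hu⟩ := exists_append_mem_levelAntichain hc0 hc1 hstep hk (hw w hwL)
    exact ⟨w ++ u, hu, by rw [← hwL.out]; exact List.take_left⟩
  have hcard : {w : List (Fin N) | w.length = L}.ncard = N ^ L := by
    rw [← Nat.card_coe_set_eq]
    change Nat.card (List.Vector (Fin N) L) = _
    rw [Nat.card_eq_fintype_card, card_vector, Fintype.card_fin]
  calc L ≤ N ^ L := (Nat.lt_pow_self (by omega)).le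
    _ = _ := hcard.symm
    _ ≤ _ := Set.ncard_le_ncard hsub (hfin.image _)
    _ ≤ _ := Set.ncard_image_le hfin

lemma etaLow_pos [Nonempty (Fin N)] (hp0 : 0 < p0) (hs : ∀ i, 0 < s i) (ht : ∀ i, 0 < t i)
    (hp : ∀ i, 0 < p i) : 0 < etaLow r p0 s t p := by
  obtain ⟨i, hi⟩ := exists_eq_ciInf_of_finite
    (f := fun i => min (p0 * t i + p i) (t i) * s i ^ r)
  rw [etaLow, ← hi]
  have h1 := mul_pos hp0 (ht i)
  have h2 := hp i
  exact mul_pos (lt_min (by linarith) (ht i)) (Real.rpow_pos_of_pos (hs i) r)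

lemma etaLow_le_one [Nonempty (Fin N)] (hr : 0 < r) (hs : ∀ i, 0 < s i) (hs1 : ∀ i, s i < 1)
    (ht : ∀ i, 0 < t i) (ht1 : ∑ i, t i = 1) : etaLow r p0 s t p ≤ 1 := by
  obtain ⟨i⟩ := ‹Nonempty (Fin N)›
  have hti : t i ≤ 1 := ht1 ▸
    Finset.single_le_sum (f := t) (fun j _ => (ht j).le) (Finset.mem_univ i)
  have hsr := Real.rpow_pos_of_pos (hs i) r
  calc _ ≤ min (p0 * t i + p i) (t i) * s i ^ r := ciInf_le (Set.finite_range _).bddBelow i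
    _ ≤ t i * s i ^ r := mul_le_mul_of_nonneg_right (min_le_right _ _) hsr.le
    _ ≤ 1 := mul_le_one₀ hti hsr.le (Real.rpow_le_one (hs i).le (hs1 i).le hr.le)

end Antichain

/-- Lemma (Zhu): with `N_{k,r} = card Λ_{k,r}`,
`P̲ = liminf_k N_{k,r}^{1/s} e_{N_{k,r},r}(μ)`, `P̄` the corresponding limsup, and
`Q̲, Q̄` the lower/upper quantization coefficients, one has
`Q̲ > 0 ↔ P̲ > 0`, `Q̲ < ∞ ↔ P̲ < ∞`, `Q̄ > 0 ↔ P̄ > 0` and `Q̄ < ∞ ↔ P̄ < ∞`. -/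
theorem quantization_coefficient_iff_antichain_coefficient
    (q N : ℕ) (hq : 1 ≤ q) (hN : 2 ≤ N) (r : ℝ) (hr : 0 < r)
    (f : Fin N → EuclideanSpace ℝ (Fin q) → EuclideanSpace ℝ (Fin q))
    (s : Fin N → ℝ) (hs : ∀ i, s i ∈ Set.Ioo (0 : ℝ) 1)
    (hf : ∀ i x y, dist (f i x) (f i y) = s i * dist x y)
    (E : Set (EuclideanSpace ℝ (Fin q)))
    (hEcpt : IsCompact E) (hEne : E.Nonempty) (hEss : E = ⋃ i, f i '' E)
    (hEdiam : Metric.diam E = 1)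
    (t : Fin N → ℝ) (ht : ∀ i, 0 < t i) (ht1 : ∑ i, t i = 1)
    (ν : Measure (EuclideanSpace ℝ (Fin q))) (hνP : IsProbabilityMeasure ν)
    (hνc : ∃ K, IsCompact K ∧ ν Kᶜ = 0)
    (hνss : ν = ∑ i, ENNReal.ofReal (t i) • ν.map (f i))
    (p0 : ℝ) (p : Fin N → ℝ) (hp0 : 0 < p0) (hp : ∀ i, 0 < p i)
    (hp1 : p0 + ∑ i, p i = 1)
    (μ : Measure (EuclideanSpace ℝ (Fin q))) (hμP : IsProbabilityMeasure μ)
    (hμc : ∃ K, IsCompact K ∧ μ Kᶜ = 0)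
    (hμss : μ = ENNReal.ofReal p0 • ν + ∑ i, ENNReal.ofReal (p i) • μ.map (f i))
    :
    ∀ x : ℝ, 0 < x →
      ((0 < liminf (fun n : ℕ =>
          (((n : ℝ) ^ (1 / x) * quantErr μ n r : ℝ) : EReal)) atTop) ↔
       (0 < liminf (fun k : ℕ =>
          ((((Lam r p0 s t p k).ncard : ℝ) ^ (1 / x)
            * quantErr μ ((Lam r p0 s t p k).ncard) r : ℝ) : EReal)) atTop)) ∧
      ((liminf (fun n : ℕ =>
          (((n : ℝ) ^ (1 / x) * quantErr μ n r : ℝ) : EReal)) atTop < ⊤) ↔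
       (liminf (fun k : ℕ =>
          ((((Lam r p0 s t p k).ncard : ℝ) ^ (1 / x)
            * quantErr μ ((Lam r p0 s t p k).ncard) r : ℝ) : EReal)) atTop < ⊤)) ∧
      ((0 < limsup (fun n : ℕ =>
          (((n : ℝ) ^ (1 / x) * quantErr μ n r : ℝ) : EReal)) atTop) ↔
       (0 < limsup (fun k : ℕ =>
          ((((Lam r p0 s t p k).ncard : ℝ) ^ (1 / x)
            * quantErr μ ((Lam r p0 s t p k).ncard) r : ℝ) : EReal)) atTop)) ∧
      ((limsup (fun n : ℕ =>
          (((n : ℝ) ^ (1 / x) * quantErr μ n r : ℝ) : EReal)) atTop < ⊤) ↔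
       (limsup (fun k : ℕ =>
          ((((Lam r p0 s t p k).ncard : ℝ) ^ (1 / x)
            * quantErr μ ((Lam r p0 s t p k).ncard) r : ℝ) : EReal)) atTop < ⊤)) := by
  intro x hx
  have : NeZero N := ⟨by omega⟩
  have hs0 i := (hs i).1
  obtain ⟨i₀, hi₀⟩ := exists_eq_ciSup_of_finite (f := fun i => s i ^ r)
  have hc (i) : s i ^ r ≤ s i₀ ^ r := by
    simpa only [hi₀] using le_ciSup (f := fun i => s i ^ r) (Set.finite_range _).bddAbove i
  have hc0 : 0 ≤ s i₀ ^ r := (Real.rpow_pos_of_pos (hs0 i₀) r).le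
  have hc1 : s i₀ ^ r < 1 := Real.rpow_lt_one (hs0 i₀).le (hs i₀).2 hr
  have hstep := hfun_concat_le (r := r) hp0 hs0 ht hp ht1 hp1 hc
  have hη : 0 < etaLow r p0 s t p := etaLow_pos hp0 hs0 ht hp
  have hη1 : etaLow r p0 s t p ≤ 1 := etaLow_le_one hr hs0 (fun i => (hs i).2) ht ht1
  have htend : Tendsto (fun k => (Lam r p0 s t p k).ncard) atTop atTop :=
    tendsto_ncard_levelAntichain hN hc0 hc1 hstep (hfun_pos hp0 hs0 ht hp)
      (ε := fun k => etaLow r p0 s t p / k)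
      ((eventually_gt_atTop 0).mono fun k hk => div_pos hη (Nat.cast_pos.2 hk))
      (tendsto_const_div_atTop_nhds_zero_nat _)
  obtain ⟨C, hC⟩ := exists_ncard_levelAntichain_le hc0 hc1 hstep
  refine coefficient_iff_of_bounded_growth (fun n => quantErr_nonneg μ n r)
    (quantErr_le_of_le μ r) htend (C := C) (fun k hk => ?_) hx
  have hk' : (1 : ℝ) ≤ k := by exact_mod_cast hk
  refine hC (etaLow r p0 s t p / k) (etaLow r p0 s t p / (k + 1 : ℕ)) (by positivity) ?_ ?_ ?_
  · rw [hfun_nil, div_le_one (by positivity)]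
    linarith
  · gcongr
    omega
  · rw [Nat.cast_succ, ← mul_div_assoc, div_le_div_iff₀ (by positivity) (by positivity)]
    nlinarith
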